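/- For every ξ = (ξ₀,ξ₁,ξ₂,ξ₃) ∈ ℝ⁴ with (ξ₁,ξ₂,ξ₃) ≠ (0,0,0), the nine vectors η₁(ξ), …, η₉(ξ) ∈ ℂ^55 are linearly independent over ℂ, satisfy B(ξ)·η_j(ξ) = 0 for each 1 ≤ j ≤ 9, and every Y ∈ ℂ^55 with B(ξ)·Y = 0 is a linear combination of η₁(ξ), …, η₉(ξ); that is, they form a basis of the null space of B(ξ). -/

import Mathlib

open Matrix Complex

/-- `e i` is the `i`-th standard basis vector of `ℂ^55` (`1 ≤ i ≤ 55`, one-based). -/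
def e (i : ℕ) : Fin 55 → ℂ := fun j => if (j : ℕ) + 1 = i then 1 else 0

def α₁ : Fin 55 → ℂ := e 5 + e 10
def α₂ (μ τ : ℝ) : Fin 55 → ℂ :=
  (τ : ℂ) • e 13 - (μ : ℂ) • (e 18 + e 19 + e 20) + e 47 + e 48 + e 49
def α₃ (μ τ : ℝ) : Fin 55 → ℂ :=
  (τ : ℂ) • e 14 - (μ : ℂ) • (e 28 + e 29 + e 30) + e 50 + e 51 + e 52
def α₄ (μ τ : ℝ) : Fin 55 → ℂ :=
  (τ : ℂ) • e 15 - (μ : ℂ) • (e 38 + e 39 + e 40) + e 53 + e 54 + e 55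

/-- The `16 × 55` matrix `H`. -/
def Hm (μ τ : ℝ) : Matrix (Fin 16) (Fin 55) ℂ :=
  Matrix.of ![-α₁, -α₂ μ τ, -α₃ μ τ, -α₄ μ τ, e 1, e 2, e 3, e 4, e 5, e 6, e 7, e 8,
    e 9, e 10, e 11, e 16]

/-- The `16 × 55` matrix `H₀`. -/
def Hm0 (μ τ : ℝ) : Matrix (Fin 16) (Fin 55) ℂ :=
  Matrix.of ![e 21, e 17, e 27, e 37, e 22, e 23, -α₂ μ τ, e 31, e 32, e 33, -α₃ μ τ,
    e 41, e 42, e 43, -α₄ μ τ, e 12]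

/-- The `16 × 55` matrix `H₁`. -/
def Hm1 : Matrix (Fin 16) (Fin 55) ℂ :=
  Matrix.of ![e 18, e 21, e 31, e 41, e 24, e 25, -α₁, e 28, e 34, e 35, e 4, e 38,
    e 44, e 45, e 8, e 13]

/-- The `16 × 55` matrix `H₂`. -/
def Hm2 : Matrix (Fin 16) (Fin 55) ℂ :=
  Matrix.of ![e 24, e 22, e 32, e 42, e 19, e 26, e 1, e 34, e 29, e 36, e 5, e 44,
    e 39, e 46, e 9, e 14]

/-- The `16 × 55` matrix `H₃`. -/
def Hm3 : Matrix (Fin 16) (Fin 55) ℂ :=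
  Matrix.of ![e 25, e 23, e 33, e 43, e 26, e 20, e 2, e 35, e 36, e 30, e 6, e 45,
    e 46, e 40, e 10, e 15]

/-- The four matrices `H₀, H₁, H₂, H₃`. -/
def HmB (μ τ : ℝ) : Fin 4 → Matrix (Fin 16) (Fin 55) ℂ := ![Hm0 μ τ, Hm1, Hm2, Hm3]

/-- The `64 × 55` complex matrix `B(ξ)`, obtained by stacking the four `16 × 55` blocks
`iξ₀H − H₀`, `iξ₁H − H₁`, `iξ₂H − H₂`, `iξ₃H − H₃`. -/
noncomputable def B (μ τ : ℝ) (ξ : Fin 4 → ℝ) : Matrix (Fin 64) (Fin 55) ℂ :=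
  Matrix.of fun i j =>
    Complex.I * (ξ ⟨(i : ℕ) / 16, by have := i.isLt; omega⟩ : ℂ) *
        Hm μ τ ⟨(i : ℕ) % 16, by have := i.isLt; omega⟩ j
      - HmB μ τ ⟨(i : ℕ) / 16, by have := i.isLt; omega⟩
          ⟨(i : ℕ) % 16, by have := i.isLt; omega⟩ j

/-- `a(ξ) = (μ((iξ₁)² + (iξ₂)² + (iξ₃)²) − iξ₀)/τ`. -/
noncomputable def aC (μ τ : ℝ) (ξ : Fin 4 → ℝ) : ℂ :=
  ((μ : ℂ) * ((Complex.I * ξ 1) ^ 2 + (Complex.I * ξ 2) ^ 2 + (Complex.I * ξ 3) ^ 2)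
    - Complex.I * ξ 0) / (τ : ℂ)

/-- `b(ξ) = ((iξ₁)² + (iξ₂)² + (iξ₃)²)/a(ξ)`. -/
noncomputable def bC (μ τ : ℝ) (ξ : Fin 4 → ℝ) : ℂ :=
  ((Complex.I * ξ 1) ^ 2 + (Complex.I * ξ 2) ^ 2 + (Complex.I * ξ 3) ^ 2) / aC μ τ ξ

/-- The vector `Y(y₃, y₇, y₁₁, y₁₆, w) ∈ ℂ^55`. -/
noncomputable def Yv (ξ : Fin 4 → ℝ) (y3 y7 y11 y16 : ℂ) (w : Fin 9 → ℂ) : Fin 55 → ℂ :=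
  let z : Fin 4 → ℂ := fun k => Complex.I * ξ k
  ![z 2 * y3, z 3 * y3, y3,
    z 1 * y7, z 2 * y7, z 3 * y7, y7,
    z 1 * y11, z 2 * y11, z 3 * y11, y11,
    z 0 * y16, z 1 * y16, z 2 * y16, z 3 * y16, y16,
    (z 0) ^ 2 * y3, (z 1) ^ 2 * y3, (z 2) ^ 2 * y3, (z 3) ^ 2 * y3,
    z 0 * z 1 * y3, z 0 * z 2 * y3, z 0 * z 3 * y3,
    z 1 * z 2 * y3, z 1 * z 3 * y3, z 2 * z 3 * y3,
    (z 0) ^ 2 * y7, (z 1) ^ 2 * y7, (z 2) ^ 2 * y7, (z 3) ^ 2 * y7,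
    z 0 * z 1 * y7, z 0 * z 2 * y7, z 0 * z 3 * y7,
    z 1 * z 2 * y7, z 1 * z 3 * y7, z 2 * z 3 * y7,
    (z 0) ^ 2 * y11, (z 1) ^ 2 * y11, (z 2) ^ 2 * y11, (z 3) ^ 2 * y11,
    z 0 * z 1 * y11, z 0 * z 2 * y11, z 0 * z 3 * y11,
    z 1 * z 2 * y11, z 1 * z 3 * y11, z 2 * z 3 * y11,
    w 0, w 1, w 2, w 3, w 4, w 5, w 6, w 7, w 8]

/-- `ê j` is the `j`-th standard basis vector of `ℂ⁹`. -/
def eh (j : Fin 9) : Fin 9 → ℂ := fun k => if k = j then 1 else 0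

/-- The nine null-space vectors `η₁(ξ), …, η₉(ξ)` (indexed by `Fin 9`, zero-based). -/
noncomputable def ηv (μ τ : ℝ) (ξ : Fin 4 → ℝ) (j : Fin 9) : Fin 55 → ℂ :=
  let a := aC μ τ ξ
  let b := bC μ τ ξ
  let D := a ^ 2 * b * (τ : ℂ)
  if (j : ℕ) < 3 then
    Yv ξ ((ξ 1 : ℂ) ^ 2 / D + 1 / (a * τ)) ((ξ 1 : ℂ) * (ξ 2 : ℂ) / D)
      ((ξ 1 : ℂ) * (ξ 3 : ℂ) / D) (-(Complex.I * ξ 1) / (a * b * τ)) (eh j)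
  else if (j : ℕ) < 6 then
    Yv ξ ((ξ 1 : ℂ) * (ξ 2 : ℂ) / D) ((ξ 2 : ℂ) ^ 2 / D + 1 / (a * τ))
      ((ξ 2 : ℂ) * (ξ 3 : ℂ) / D) (-(Complex.I * ξ 2) / (a * b * τ)) (eh j)
  else
    Yv ξ ((ξ 1 : ℂ) * (ξ 3 : ℂ) / D) ((ξ 2 : ℂ) * (ξ 3 : ℂ) / D)
      ((ξ 3 : ℂ) ^ 2 / D + 1 / (a * τ)) (-(Complex.I * ξ 3) / (a * b * τ)) (eh j)

/-- The particular solution `Y₁(ξ, f)`. -/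
noncomputable def Y1 (μ τ : ℝ) (ξ : Fin 4 → ℝ) (f : Fin 3 → ℂ) : Fin 55 → ℂ :=
  let a := aC μ τ ξ
  let b := bC μ τ ξ
  let D := a ^ 2 * b * (τ : ℂ)
  let S := Complex.I * ξ 1 * f 0 + Complex.I * ξ 2 * f 1 + Complex.I * ξ 3 * f 2
  Yv ξ (Complex.I * ξ 1 * S / D - f 0 / (a * τ)) (Complex.I * ξ 2 * S / D - f 1 / (a * τ))
    (Complex.I * ξ 3 * S / D - f 2 / (a * τ)) (S / (a * b * τ)) 0

/-- The right-hand side `G(ξ, f) ∈ ℂ⁶⁴`: the stack of the four `16`-blocks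
`g⁰(f) − iξ₀ g¹(f)`, `−iξ₁ g¹(f)`, `−iξ₂ g¹(f)`, `−iξ₃ g¹(f)`. -/
noncomputable def Gv (ξ : Fin 4 → ℝ) (f : Fin 3 → ℂ) : Fin 64 → ℂ := fun i =>
  let g1 : Fin 16 → ℂ := ![0, f 0, f 1, f 2, 0, 0, 0, 0, 0, 0, 0, 0, 0, 0, 0, 0]
  let g0 : Fin 16 → ℂ := ![0, 0, 0, 0, 0, 0, f 0, 0, 0, 0, f 1, 0, 0, 0, f 2, 0]
  if h : (i : ℕ) < 16 then
    g0 ⟨(i : ℕ), h⟩ - Complex.I * ξ 0 * g1 ⟨(i : ℕ), h⟩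
  else
    -(Complex.I * (ξ ⟨(i : ℕ) / 16, by have := i.isLt; omega⟩ : ℂ)) *
      g1 ⟨(i : ℕ) % 16, by have := i.isLt; omega⟩

theorem e_dot (Y : Fin 55 → ℂ) (n : ℕ) (h : n - 1 < 55) (hn : 0 < n) :
    e n ⬝ᵥ Y = Y ⟨n - 1, h⟩ := by
  unfold dotProduct e
  rw [Finset.sum_eq_single ⟨n - 1, h⟩]
  · simp; omega
  · intro b _ hb
    have : (b : ℕ) + 1 ≠ n := by
      intro h'; apply hb; ext; simp; omega
    simp [this]
  · simp

theorem B_iff (μ τ : ℝ) (ξ : Fin 4 → ℝ) (Y : Fin 55 → ℂ) :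
    (B μ τ ξ).mulVec Y = 0 ↔
      ∀ k : Fin 4, ∀ r : Fin 16,
        Complex.I * (ξ k : ℂ) * (Hm μ τ r ⬝ᵥ Y) = HmB μ τ k r ⬝ᵥ Y := by
  have key : ∀ i : Fin 64, (B μ τ ξ).mulVec Y i =
      Complex.I * (ξ ⟨(i : ℕ) / 16, by have := i.isLt; omega⟩ : ℂ) *
        (Hm μ τ ⟨(i : ℕ) % 16, by have := i.isLt; omega⟩ ⬝ᵥ Y)
      - HmB μ τ ⟨(i : ℕ) / 16, by have := i.isLt; omega⟩
          ⟨(i : ℕ) % 16, by have := i.isLt; omega⟩ ⬝ᵥ Y := by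
    intro i
    rw [Matrix.mulVec]
    simp only [dotProduct, Finset.mul_sum, ← Finset.sum_sub_distrib, B, Matrix.of_apply]
    refine Finset.sum_congr rfl fun j _ => ?_
    ring
  constructor
  · intro h k r
    have h1 := congrFun h ⟨16 * (k : ℕ) + r, by omega⟩
    rw [key, Pi.zero_apply, sub_eq_zero] at h1
    have hk : (16 * (k : ℕ) + r) / 16 = k := by omega
    have hr : (16 * (k : ℕ) + r) % 16 = r := by omega
    simpa only [hk, hr] using h1
  · intro h
    funext i
    rw [key, Pi.zero_apply, sub_eq_zero]
    exact h _ _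

theorem alpha1_dot (Y : Fin 55 → ℂ) : α₁ ⬝ᵥ Y = Y 4 + Y 9 := by
  simp [α₁, e_dot, add_dotProduct]
theorem alpha2_dot (μ τ : ℝ) (Y : Fin 55 → ℂ) : α₂ μ τ ⬝ᵥ Y =
    τ * Y 12 - μ * (Y 17 + Y 18 + Y 19) + Y 46 + Y 47 + Y 48 := by
  simp [α₂, e_dot, add_dotProduct, sub_dotProduct, mul_add]
theorem alpha3_dot (μ τ : ℝ) (Y : Fin 55 → ℂ) : α₃ μ τ ⬝ᵥ Y =
    τ * Y 13 - μ * (Y 27 + Y 28 + Y 29) + Y 49 + Y 50 + Y 51 := by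
  simp [α₃, e_dot, add_dotProduct, sub_dotProduct, mul_add]
theorem alpha4_dot (μ τ : ℝ) (Y : Fin 55 → ℂ) : α₄ μ τ ⬝ᵥ Y =
    τ * Y 14 - μ * (Y 37 + Y 38 + Y 39) + Y 52 + Y 53 + Y 54 := by
  simp [α₄, e_dot, add_dotProduct, sub_dotProduct, mul_add]

theorem ofRow_apply (f : Fin 16 → Fin 55 → ℂ) (r : Fin 16) :
    (Matrix.of f : Matrix (Fin 16) (Fin 55) ℂ) r = f r := rfl

theorem H_dot (μ τ : ℝ) (Y : Fin 55 → ℂ) (r : Fin 16) : Hm μ τ r ⬝ᵥ Y =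
    ![-(α₁ ⬝ᵥ Y), -(α₂ μ τ ⬝ᵥ Y), -(α₃ μ τ ⬝ᵥ Y), -(α₄ μ τ ⬝ᵥ Y), Y 0, Y 1, Y 2, Y 3, Y 4,
      Y 5, Y 6, Y 7, Y 8, Y 9, Y 10, Y 15] r := by
  fin_cases r <;> simp [Hm, ofRow_apply, e_dot, neg_dotProduct]
theorem H0_dot (μ τ : ℝ) (Y : Fin 55 → ℂ) (r : Fin 16) : HmB μ τ 0 r ⬝ᵥ Y =
    ![Y 20, Y 16, Y 26, Y 36, Y 21, Y 22, -(α₂ μ τ ⬝ᵥ Y), Y 30, Y 31, Y 32, -(α₃ μ τ ⬝ᵥ Y),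
      Y 40, Y 41, Y 42, -(α₄ μ τ ⬝ᵥ Y), Y 11] r := by
  fin_cases r <;> simp [HmB, Hm0, ofRow_apply, e_dot, neg_dotProduct]
theorem H1_dot (μ τ : ℝ) (Y : Fin 55 → ℂ) (r : Fin 16) : HmB μ τ 1 r ⬝ᵥ Y =
    ![Y 17, Y 20, Y 30, Y 40, Y 23, Y 24, -(α₁ ⬝ᵥ Y), Y 27, Y 33, Y 34, Y 3, Y 37, Y 43, Y 44,
      Y 7, Y 12] r := by
  fin_cases r <;> simp [HmB, Hm1, ofRow_apply, e_dot, neg_dotProduct]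
theorem H2_dot (μ τ : ℝ) (Y : Fin 55 → ℂ) (r : Fin 16) : HmB μ τ 2 r ⬝ᵥ Y =
    ![Y 23, Y 21, Y 31, Y 41, Y 18, Y 25, Y 0, Y 33, Y 28, Y 35, Y 4, Y 43, Y 38, Y 45, Y 8,
      Y 13] r := by
  fin_cases r <;> simp [HmB, Hm2, ofRow_apply, e_dot, neg_dotProduct]
theorem H3_dot (μ τ : ℝ) (Y : Fin 55 → ℂ) (r : Fin 16) : HmB μ τ 3 r ⬝ᵥ Y =
    ![Y 24, Y 22, Y 32, Y 42, Y 25, Y 19, Y 1, Y 34, Y 35, Y 29, Y 5, Y 44, Y 45, Y 39, Y 9,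
      Y 14] r := by
  fin_cases r <;> simp [HmB, Hm3, ofRow_apply, e_dot, neg_dotProduct]

set_option maxHeartbeats 1000000 in
theorem B_Yv (μ τ : ℝ) (ξ : Fin 4 → ℝ) (u v w p : ℂ) (W : Fin 9 → ℂ)
    (h1 : α₁ ⬝ᵥ Yv ξ u v w p W = -(I * ξ 1 * u))
    (h2 : α₂ μ τ ⬝ᵥ Yv ξ u v w p W = -(I * ξ 0 * u))
    (h3 : α₃ μ τ ⬝ᵥ Yv ξ u v w p W = -(I * ξ 0 * v))
    (h4 : α₄ μ τ ⬝ᵥ Yv ξ u v w p W = -(I * ξ 0 * w)) :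
    (B μ τ ξ).mulVec (Yv ξ u v w p W) = 0 := by
  rw [B_iff]
  intro k r
  rw [H_dot, h1, h2, h3, h4]
  fin_cases k
  · change _ = HmB μ τ 0 r ⬝ᵥ _
    rw [H0_dot, h2, h3, h4]
    fin_cases r <;> simp [Yv] <;> ring
  · change _ = HmB μ τ 1 r ⬝ᵥ _
    rw [H1_dot, h1]
    fin_cases r <;> simp [Yv] <;> ring
  · change _ = HmB μ τ 2 r ⬝ᵥ _
    rw [H2_dot]
    fin_cases r <;> simp [Yv] <;> ring
  · change _ = HmB μ τ 3 r ⬝ᵥ _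
    rw [H3_dot]
    fin_cases r <;> simp [Yv] <;> ring

set_option maxHeartbeats 1000000 in
theorem ker_Yv (μ τ : ℝ) (ξ : Fin 4 → ℝ) (Y : Fin 55 → ℂ)
    (h : (B μ τ ξ).mulVec Y = 0) :
    α₁ ⬝ᵥ Y = -(I * ξ 1 * Y 2) ∧ α₂ μ τ ⬝ᵥ Y = -(I * ξ 0 * Y 2) ∧
    α₃ μ τ ⬝ᵥ Y = -(I * ξ 0 * Y 6) ∧ α₄ μ τ ⬝ᵥ Y = -(I * ξ 0 * Y 10) ∧
    Y = Yv ξ (Y 2) (Y 6) (Y 10) (Y 15) (fun k => Y ⟨46 + k, by omega⟩) := by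
  rw [B_iff] at h
  have g0 := h 0
  have g1 := h 1
  have g2 := h 2
  have g3 := h 3
  clear h
  simp only [H_dot, H0_dot, H1_dot, H2_dot, H3_dot] at g0 g1 g2 g3
  have h1 : α₁ ⬝ᵥ Y = -(I * ξ 1 * Y 2) := by
    have := g1 6
    simp at this; rw [this]; simp
  have h2 : α₂ μ τ ⬝ᵥ Y = -(I * ξ 0 * Y 2) := by
    have := g0 6
    simp at this; rw [this]; simp
  have h3 : α₃ μ τ ⬝ᵥ Y = -(I * ξ 0 * Y 6) := by
    have := g0 10
    simp at this; rw [this]; simp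
  have h4 : α₄ μ τ ⬝ᵥ Y = -(I * ξ 0 * Y 10) := by
    have := g0 14
    simp at this; rw [this]; simp
  refine ⟨h1, h2, h3, h4, ?_⟩
  simp only [h1, h2, h3, h4] at g0 g1 g2 g3
  clear h1 h2 h3 h4
  simp only [Fin.forall_fin_succ] at g0 g1 g2 g3
  simp at g0 g1 g2 g3
  funext i
  fin_cases i <;> simp [Yv]
  all_goals grind

theorem s_ne (ξ : Fin 4 → ℝ) (hξ : ¬(ξ 1 = 0 ∧ ξ 2 = 0 ∧ ξ 3 = 0)) :
    0 < ξ 1 ^ 2 + ξ 2 ^ 2 + ξ 3 ^ 2 := by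
  by_contra h
  apply hξ
  refine ⟨?_, ?_, ?_⟩ <;> nlinarith [sq_nonneg (ξ 1), sq_nonneg (ξ 2), sq_nonneg (ξ 3)]

theorem s_eq (ξ : Fin 4 → ℝ) : (I * ξ 1) ^ 2 + (I * ξ 2) ^ 2 + (I * ξ 3) ^ 2 =
    -((ξ 1 ^ 2 + ξ 2 ^ 2 + ξ 3 ^ 2 : ℝ) : ℂ) := by
  push_cast
  linear_combination ((ξ 1 : ℂ) ^ 2 + ξ 2 ^ 2 + ξ 3 ^ 2) * I_sq

theorem aC_ne (μ τ : ℝ) (hμ : 0 < μ) (hτ : 0 < τ)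
    (ξ : Fin 4 → ℝ) (hξ : ¬(ξ 1 = 0 ∧ ξ 2 = 0 ∧ ξ 3 = 0)) : aC μ τ ξ ≠ 0 := by
  have hs := s_ne ξ hξ
  unfold aC
  rw [s_eq]
  refine div_ne_zero ?_ (by exact_mod_cast hτ.ne')
  intro h
  have h1 := congrArg Complex.re h
  simp [-ofReal_add, -ofReal_pow] at h1
  have := mul_pos hμ hs
  rcases h1 with h1 | h1
  · exact hμ.ne' h1
  · exact hs.ne' (by linarith)

theorem bC_ne (μ τ : ℝ) (hμ : 0 < μ) (hτ : 0 < τ)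
    (ξ : Fin 4 → ℝ) (hξ : ¬(ξ 1 = 0 ∧ ξ 2 = 0 ∧ ξ 3 = 0)) : bC μ τ ξ ≠ 0 := by
  unfold bC
  rw [s_eq]
  refine div_ne_zero (neg_ne_zero.2 ?_) (aC_ne μ τ hμ hτ ξ hξ)
  exact_mod_cast (s_ne ξ hξ).ne'

/-- A null vector whose last nine entries vanish is zero. -/
theorem ker_zero (μ τ : ℝ) (hμ : 0 < μ) (hτ : 0 < τ)
    (ξ : Fin 4 → ℝ) (hξ : ¬(ξ 1 = 0 ∧ ξ 2 = 0 ∧ ξ 3 = 0)) (Y : Fin 55 → ℂ)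
    (h : (B μ τ ξ).mulVec Y = 0) (hw : ∀ k : Fin 9, Y ⟨46 + k, by omega⟩ = 0) : Y = 0 := by
  obtain ⟨h1, h2, h3, h4, hY⟩ := ker_Yv μ τ ξ Y h
  have ha := aC_ne μ τ hμ hτ ξ hξ
  have hb := bC_ne μ τ hμ hτ ξ hξ
  have ht : (τ : ℂ) ≠ 0 := by exact_mod_cast hτ.ne'
  simp only [hw] at hY
  generalize Y 2 = u at *
  generalize Y 6 = v at *
  generalize Y 10 = w at *
  generalize Y 15 = p at *
  subst hY
  rw [alpha1_dot] at h1
  rw [alpha2_dot] at h2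
  rw [alpha3_dot] at h3
  rw [alpha4_dot] at h4
  simp [Yv] at h1 h2 h3 h4
  have hat : aC μ τ ξ * τ = μ * ((I * ξ 1) ^ 2 + (I * ξ 2) ^ 2 + (I * ξ 3) ^ 2) - I * ξ 0 := by
    unfold aC; field_simp
  have hba : bC μ τ ξ * aC μ τ ξ = (I * ξ 1) ^ 2 + (I * ξ 2) ^ 2 + (I * ξ 3) ^ 2 := by
    rw [bC, div_mul_cancel₀ _ ha]
  generalize aC μ τ ξ = a at *
  generalize bC μ τ ξ = b at *
  have k2 : τ * (I * ξ 1 * p - a * u) = 0 := by linear_combination h2 - u * hat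
  have k3 : τ * (I * ξ 2 * p - a * v) = 0 := by linear_combination h3 - v * hat
  have k4 : τ * (I * ξ 3 * p - a * w) = 0 := by linear_combination h4 - w * hat
  have k2 := (mul_eq_zero.1 k2).resolve_left ht
  have k3 := (mul_eq_zero.1 k3).resolve_left ht
  have k4 := (mul_eq_zero.1 k4).resolve_left ht
  have kp : (b * a) * p = 0 := by
    linear_combination p * hba + I * ξ 1 * k2 + I * ξ 2 * k3 + I * ξ 3 * k4 + a * h1
  have hp : p = 0 := (mul_eq_zero.1 kp).resolve_left (mul_ne_zero hb ha)
  subst hp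
  have hu : u = 0 := by simpa [ha] using k2
  have hv : v = 0 := by simpa [ha] using k3
  have hw0 : w = 0 := by simpa [ha] using k4
  subst hu hv hw0
  funext i
  fin_cases i <;> simp [Yv]

theorem eta_w (μ τ : ℝ) (ξ : Fin 4 → ℝ) (j k : Fin 9) :
    ηv μ τ ξ j ⟨46 + k, by omega⟩ = eh j k := by
  have key : ∀ (u v w p : ℂ) (W : Fin 9 → ℂ), Yv ξ u v w p W ⟨46 + k, by omega⟩ = W k := by
    intro u v w p W
    fin_cases k <;> rfl
  unfold ηv
  split_ifs <;> exact key _ _ _ _ _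

theorem B_Yv' (μ τ : ℝ) (ξ : Fin 4 → ℝ) (u v w p : ℂ) (W : Fin 9 → ℂ) (ht : (τ : ℂ) ≠ 0)
    (h1 : I * ξ 1 * u + I * ξ 2 * v + I * ξ 3 * w = 0)
    (h2 : τ * (I * ξ 1 * p - aC μ τ ξ * u) + W 0 + W 1 + W 2 = 0)
    (h3 : τ * (I * ξ 2 * p - aC μ τ ξ * v) + W 3 + W 4 + W 5 = 0)
    (h4 : τ * (I * ξ 3 * p - aC μ τ ξ * w) + W 6 + W 7 + W 8 = 0) :
    (B μ τ ξ).mulVec (Yv ξ u v w p W) = 0 := by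
  have hat : aC μ τ ξ * τ = μ * ((I * ξ 1) ^ 2 + (I * ξ 2) ^ 2 + (I * ξ 3) ^ 2) - I * ξ 0 := by
    unfold aC; field_simp
  generalize aC μ τ ξ = a at *
  apply B_Yv
  · rw [alpha1_dot]; simp [Yv]; linear_combination h1
  · rw [alpha2_dot]; simp [Yv]; linear_combination h2 + u * hat
  · rw [alpha3_dot]; simp [Yv]; linear_combination h3 + v * hat
  · rw [alpha4_dot]; simp [Yv]; linear_combination h4 + w * hat

theorem B_eta (μ τ : ℝ) (hμ : 0 < μ) (hτ : 0 < τ)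
    (ξ : Fin 4 → ℝ) (hξ : ¬(ξ 1 = 0 ∧ ξ 2 = 0 ∧ ξ 3 = 0)) (j : Fin 9) :
    (B μ τ ξ).mulVec (ηv μ τ ξ j) = 0 := by
  have ha := aC_ne μ τ hμ hτ ξ hξ
  have hb := bC_ne μ τ hμ hτ ξ hξ
  have ht : (τ : ℂ) ≠ 0 := by exact_mod_cast hτ.ne'
  have hba : bC μ τ ξ * aC μ τ ξ = -((ξ 1 : ℂ) ^ 2 + ξ 2 ^ 2 + ξ 3 ^ 2) := by
    rw [bC, div_mul_cancel₀ _ ha, s_eq]; push_cast; rfl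
  have e0 : ∀ x : ℂ, I * (-(I * x)) = x := by
    intro x; linear_combination -x * I_sq
  unfold ηv
  simp only
  split_ifs with c1 c2
  · have s1 : eh j 0 + eh j 1 + eh j 2 = 1 := by
      revert c1; fin_cases j <;> simp [eh]
    have s2 : eh j 3 + eh j 4 + eh j 5 = 0 := by
      revert c1; fin_cases j <;> simp [eh]
    have s3 : eh j 6 + eh j 7 + eh j 8 = 0 := by
      revert c1; fin_cases j <;> simp [eh]
    apply B_Yv' _ _ _ _ _ _ _ _ ht <;> generalize aC μ τ ξ = a at * <;>
      generalize bC μ τ ξ = b at *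
    · field_simp
      linear_combination (ξ 1 : ℂ) * I * hba
    · have : (τ : ℂ) * (I * ξ 1 * (-(I * ξ 1) / (a * b * τ)) -
          a * ((ξ 1 : ℂ) ^ 2 / (a ^ 2 * b * τ) + 1 / (a * τ))) = -1 := by
        field_simp
        linear_combination -(ξ 1 : ℂ) ^ 2 * I_sq
      linear_combination this + s1
    · have : (τ : ℂ) * (I * ξ 2 * (-(I * ξ 1) / (a * b * τ)) -
          a * ((ξ 1 : ℂ) * ξ 2 / (a ^ 2 * b * τ))) = 0 := by
        field_simp
        linear_combination -(ξ 1 : ℂ) * ξ 2 * I_sq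
      linear_combination this + s2
    · have : (τ : ℂ) * (I * ξ 3 * (-(I * ξ 1) / (a * b * τ)) -
          a * ((ξ 1 : ℂ) * ξ 3 / (a ^ 2 * b * τ))) = 0 := by
        field_simp
        linear_combination -(ξ 1 : ℂ) * ξ 3 * I_sq
      linear_combination this + s3
  · have s1 : eh j 0 + eh j 1 + eh j 2 = 0 := by
      revert c1; fin_cases j <;> simp [eh]
    have s2 : eh j 3 + eh j 4 + eh j 5 = 1 := by
      revert c1 c2; fin_cases j <;> simp [eh]
    have s3 : eh j 6 + eh j 7 + eh j 8 = 0 := by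
      revert c2; fin_cases j <;> simp [eh]
    apply B_Yv' _ _ _ _ _ _ _ _ ht <;> generalize aC μ τ ξ = a at * <;>
      generalize bC μ τ ξ = b at *
    · field_simp
      linear_combination (ξ 2 : ℂ) * I * hba
    · have : (τ : ℂ) * (I * ξ 1 * (-(I * ξ 2) / (a * b * τ)) -
          a * ((ξ 1 : ℂ) * ξ 2 / (a ^ 2 * b * τ))) = 0 := by
        field_simp
        linear_combination -(ξ 1 : ℂ) * ξ 2 * I_sq
      linear_combination this + s1
    · have : (τ : ℂ) * (I * ξ 2 * (-(I * ξ 2) / (a * b * τ)) -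
          a * ((ξ 2 : ℂ) ^ 2 / (a ^ 2 * b * τ) + 1 / (a * τ))) = -1 := by
        field_simp
        linear_combination -(ξ 2 : ℂ) ^ 2 * I_sq
      linear_combination this + s2
    · have : (τ : ℂ) * (I * ξ 3 * (-(I * ξ 2) / (a * b * τ)) -
          a * ((ξ 2 : ℂ) * ξ 3 / (a ^ 2 * b * τ))) = 0 := by
        field_simp
        linear_combination -(ξ 2 : ℂ) * ξ 3 * I_sq
      linear_combination this + s3
  · have s1 : eh j 0 + eh j 1 + eh j 2 = 0 := by
      revert c1; fin_cases j <;> simp [eh]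
    have s2 : eh j 3 + eh j 4 + eh j 5 = 0 := by
      revert c2; fin_cases j <;> simp [eh]
    have s3 : eh j 6 + eh j 7 + eh j 8 = 1 := by
      revert c2; fin_cases j <;> simp [eh]
    apply B_Yv' _ _ _ _ _ _ _ _ ht <;> generalize aC μ τ ξ = a at * <;>
      generalize bC μ τ ξ = b at *
    · field_simp
      linear_combination (ξ 3 : ℂ) * I * hba
    · have : (τ : ℂ) * (I * ξ 1 * (-(I * ξ 3) / (a * b * τ)) -
          a * ((ξ 1 : ℂ) * ξ 3 / (a ^ 2 * b * τ))) = 0 := by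
        field_simp
        linear_combination -(ξ 1 : ℂ) * ξ 3 * I_sq
      linear_combination this + s1
    · have : (τ : ℂ) * (I * ξ 2 * (-(I * ξ 3) / (a * b * τ)) -
          a * ((ξ 2 : ℂ) * ξ 3 / (a ^ 2 * b * τ))) = 0 := by
        field_simp
        linear_combination -(ξ 2 : ℂ) * ξ 3 * I_sq
      linear_combination this + s2
    · have : (τ : ℂ) * (I * ξ 3 * (-(I * ξ 3) / (a * b * τ)) -
          a * ((ξ 3 : ℂ) ^ 2 / (a ^ 2 * b * τ) + 1 / (a * τ))) = -1 := by
        field_simp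
        linear_combination -(ξ 3 : ℂ) ^ 2 * I_sq
      linear_combination this + s3

/-- For every `ξ ∈ ℝ⁴` with `(ξ₁, ξ₂, ξ₃) ≠ (0,0,0)`, the nine vectors
`η₁(ξ), …, η₉(ξ) ∈ ℂ^55` are linearly independent over `ℂ`, lie in the null space of
`B(ξ)`, and span it: they form a basis of the null space of `B(ξ)`. -/
theorem stmt5 (μ τ : ℝ) (hμ : 0 < μ) (hτ : 0 < τ)
    (ξ : Fin 4 → ℝ) (hξ : ¬(ξ 1 = 0 ∧ ξ 2 = 0 ∧ ξ 3 = 0)) :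
    LinearIndependent ℂ (ηv μ τ ξ) ∧
    (∀ j : Fin 9, (B μ τ ξ).mulVec (ηv μ τ ξ j) = 0) ∧
    (∀ Y : Fin 55 → ℂ, (B μ τ ξ).mulVec Y = 0 →
      Y ∈ Submodule.span ℂ (Set.range (ηv μ τ ξ))) := by
  have hsum : ∀ (c : Fin 9 → ℂ) (k : Fin 9),
      (∑ j, c j • ηv μ τ ξ j) ⟨46 + k, by omega⟩ = c k := by
    intro c k
    simp only [Finset.sum_apply, Pi.smul_apply, eta_w, smul_eq_mul]
    simp [eh]
  refine ⟨?_, B_eta μ τ hμ hτ ξ hξ, ?_⟩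
  · rw [Fintype.linearIndependent_iff]
    intro g hg k
    have := hsum g k
    rw [hg] at this
    exact this.symm
  · intro Y hY
    have hZ : Y - ∑ j : Fin 9, Y ⟨46 + j, by omega⟩ • ηv μ τ ξ j = 0 := by
      apply ker_zero μ τ hμ hτ ξ hξ
      · rw [Matrix.mulVec_sub, hY, Matrix.mulVec_sum]
        simp [Matrix.mulVec_smul, B_eta μ τ hμ hτ ξ hξ]
      · intro k
        rw [Pi.sub_apply, hsum (fun j => Y ⟨46 + j, by omega⟩) k, sub_self]
    rw [sub_eq_zero.1 hZ]
    exact Submodule.sum_mem _ fun j _ =>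
      Submodule.smul_mem _ _ (Submodule.subset_span ⟨j, rfl⟩)
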